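/- For all integers n ≥ 0, a_{26}(27n + 26) ≡ 0 (mod 3). -/

import Mathlib

/-- The set of `k`-colored-odd partitions of `n`: multisets of pairs `(m, c)` with
`m` a positive integer and `c ∈ {1, …, k}`, such that `c = 1` whenever `m` is even,
and the parts `m` sum (with multiplicity) to `n`. -/
def coloredOddPartitions (k n : ℕ) : Set (Multiset (ℕ × ℕ)) :=
  {s | (∀ p ∈ s, 0 < p.1 ∧ 1 ≤ p.2 ∧ p.2 ≤ k ∧ (Even p.1 → p.2 = 1)) ∧
    (s.map Prod.fst).sum = n}

/-- `a k n` is the number of `k`-colored-odd partitions of `n`. -/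
noncomputable def a (k n : ℕ) : ℕ := Nat.card (coloredOddPartitions k n)

open PowerSeries

abbrev PS := PowerSeries (ZMod 3)

theorem cube_eq_expand (f : PS) : f ^ 3 = PowerSeries.expand 3 (by norm_num) f := by
  have : Fact (Nat.Prime 3) := ⟨by norm_num⟩
  have h := MvPowerSeries.map_frobenius_expand (R := ZMod 3) (σ := Unit) 3 (by norm_num) (f := f)
  rw [ZMod.frobenius_zmod] at h
  rw [← h, MvPowerSeries.map_id]
  rfl

theorem coeff_cube (f : PS) (n : ℕ) :
    coeff n (f ^ 3) = if 3 ∣ n then coeff (n / 3) f else 0 := by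
  rw [cube_eq_expand, PowerSeries.coeff_expand]

theorem coeff_ninth (f : PS) (n : ℕ) :
    coeff n (f ^ 9) = if 9 ∣ n then coeff (n / 9) f else 0 := by
  rw [show f ^ 9 = (f ^ 3) ^ 3 by ring, coeff_cube]
  split_ifs with h1 h2 h2
  · rw [coeff_cube, if_pos (by omega), Nat.div_div_eq_div_mul]
  · rw [coeff_cube, if_neg (by omega)]
  · omega
  · rfl

/-- extraction of the coefficients at `3n+2` -/
noncomputable def U (f : PS) : PS := PowerSeries.mk fun n => coeff (3 * n + 2) f

theorem U_add (f g : PS) : U (f + g) = U f + U g := by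
  ext n; simp [U]

theorem U_cube_mul (f g : PS) : U (f ^ 3 * g) = f * U g := by
  ext n
  simp only [U, coeff_mk, PowerSeries.coeff_mul]
  symm
  apply Finset.sum_of_injOn (fun p : ℕ × ℕ => (3 * p.1, 3 * p.2 + 2))
  · intro p _ q _ h
    simp only [Prod.mk.injEq] at h
    ext <;> omega
  · intro p hp
    have hp := Finset.HasAntidiagonal.mem_antidiagonal.mp (Finset.mem_coe.mp hp)
    apply Finset.mem_coe.mpr
    apply Finset.HasAntidiagonal.mem_antidiagonal.mpr
    simp only
    omega
  · intro p hp hp'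
    rw [coeff_cube, if_neg, zero_mul]
    intro h
    apply hp'
    simp only [Finset.HasAntidiagonal.mem_antidiagonal] at hp
    refine ⟨(p.1 / 3, (p.2 - 2) / 3), ?_, ?_⟩
    · apply Finset.mem_coe.mpr
      apply Finset.HasAntidiagonal.mem_antidiagonal.mpr
      simp only
      omega
    · ext <;> simp only <;> omega
  · intro p hp
    rw [coeff_cube, if_pos (by simp)]
    simp

theorem U_one : U 1 = 0 := by
  ext n
  simp only [U, coeff_mk, PowerSeries.coeff_one]
  rw [if_neg (by omega)]; simp

theorem U_X : U X = 0 := by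
  ext n
  simp only [U, coeff_mk, PowerSeries.coeff_X]
  rw [if_neg (by omega)]; simp

theorem U_X2 : U (X ^ 2) = 1 := by
  ext n
  simp only [U, coeff_mk, PowerSeries.coeff_X_pow, PowerSeries.coeff_one]
  congr 1
  simp

open Classical in
/-- The theta series of Gauss: sum of `q^(s(s+1)/2)` -/
noncomputable def psi : PS := PowerSeries.mk fun n => if ∃ s, s * (s + 1) = 2 * n then 1 else 0

noncomputable def psiA : PS := PowerSeries.mk fun n => coeff (3 * n) psi

theorem tri_two (m : ℕ) : ¬ ∃ s, s * (s + 1) = 2 * (3 * m + 2) := by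
  rintro ⟨s, hs⟩
  have h : (s * (s + 1)) % 3 = 1 := by omega
  rw [Nat.mul_mod, Nat.add_mod] at h
  have : s % 3 < 3 := Nat.mod_lt _ (by norm_num)
  interval_cases s % 3 <;> simp at h

theorem tri_one (m : ℕ) : (∃ s, s * (s + 1) = 2 * (3 * m + 1)) ↔
    (3 ∣ m ∧ ∃ s, s * (s + 1) = 2 * (m / 3)) := by
  constructor
  · rintro ⟨s, hs⟩
    have h : (s * (s + 1)) % 3 = 2 := by omega
    rw [Nat.mul_mod, Nat.add_mod] at h
    have h1 : s % 3 = 1 := by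
      have : s % 3 < 3 := Nat.mod_lt _ (by norm_num)
      interval_cases s % 3 <;> simp at h ⊢
    obtain ⟨t, rfl⟩ : ∃ t, s = 3 * t + 1 := ⟨s / 3, by omega⟩
    have h2 : 9 * (t * (t + 1)) = 6 * m := by nlinarith
    have h3 : 3 ∣ m := by omega
    exact ⟨h3, t, by omega⟩
  · rintro ⟨h, t, ht⟩
    refine ⟨3 * t + 1, ?_⟩
    have : 2 * m = 3 * (t * (t + 1)) := by omega
    nlinarith

theorem psi_dissect : psi = psiA ^ 3 * 1 + (psi ^ 3) ^ 3 * X := by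
  ext n
  rw [map_add, mul_one, coeff_cube, show (psi ^ 3) ^ 3 = psi ^ 9 by ring]
  rcases Nat.eq_zero_or_pos n with rfl | hn
  · rw [if_pos (by simp)]
    simp [psiA]
  obtain ⟨k, rfl⟩ : ∃ k, n = k + 1 := ⟨n - 1, by omega⟩
  rw [PowerSeries.coeff_succ_mul_X, coeff_ninth]
  by_cases h0 : 3 ∣ k + 1
  · rw [if_pos h0, if_neg (by omega), add_zero, psiA, coeff_mk]
    congr 2; omega
  rw [if_neg h0, zero_add]
  by_cases h1 : 3 ∣ k
  · obtain ⟨m, rfl⟩ := h1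
    have := tri_one m
    simp only [psi, coeff_mk]
    by_cases h3 : 3 ∣ m
    · rw [if_pos (show 9 ∣ 3 * m by omega), show 3 * m / 9 = m / 3 by omega]
      congr 1
      exact propext ⟨fun h => (this.mp h).2, fun h => this.mpr ⟨h3, h⟩⟩
    · rw [if_neg (show ¬ 9 ∣ 3 * m by omega), if_neg (fun h => h3 (this.mp h).1)]
  · rw [if_neg (by omega)]
    obtain ⟨m, hm⟩ : ∃ m, k + 1 = 3 * m + 2 := ⟨(k + 1) / 3, by omega⟩
    rw [hm, psi, coeff_mk, if_neg (tri_two m)]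

theorem U_psi : U psi = 0 := by
  rw [psi_dissect, U_add, U_cube_mul, U_cube_mul, U_one, U_X]; simp

theorem U_psi_sq : U (psi ^ 2) = psi ^ 6 := by
  have h : psi ^ 2 = (psiA ^ 2) ^ 3 * 1 + ((2 * psiA * psi ^ 3) ^ 3 * X + (psi ^ 6) ^ 3 * X ^ 2) := by
    have h3 : (3 : PS) = 0 := by
      have : (3 : ZMod 3) = 0 := rfl
      calc (3 : PS) = C (3 : ZMod 3) := (map_ofNat C 3).symm
        _ = 0 := by rw [this, map_zero]
    conv_lhs => rw [psi_dissect]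
    linear_combination (-2 * psiA ^ 3 * psi ^ 9 * X) * h3
  rw [h, U_add, U_add, U_cube_mul, U_cube_mul, U_cube_mul, U_one, U_X, U_X2]; simp

theorem coeff_main (J : PS) (n : ℕ) : coeff (27 * n + 26) (psi ^ 26 * J ^ 27) = 0 := by
  have key : U (U (U (psi ^ 26 * J ^ 27))) = 0 := by
    rw [show psi ^ 26 * J ^ 27 = (psi ^ 8 * J ^ 9) ^ 3 * psi ^ 2 by ring, U_cube_mul, U_psi_sq,
      show psi ^ 8 * J ^ 9 * psi ^ 6 = (psi ^ 4 * J ^ 3) ^ 3 * psi ^ 2 by ring, U_cube_mul,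
      U_psi_sq, show psi ^ 4 * J ^ 3 * psi ^ 6 = (psi ^ 3 * J) ^ 3 * psi by ring, U_cube_mul,
      U_psi, mul_zero]
  have := congrArg (coeff n) key
  simp only [U, coeff_mk, map_zero] at this
  rw [← this]
  congr 2; ring

/-! ### The finite form (Shanks) of the identity of Gauss -/

section shanks
variable {R : Type*} [CommRing R] (q : R) (v : ℕ → R)

def QQ (n s : ℕ) : R := ∏ k ∈ Finset.Ico s n, ((1 - q ^ (2 * k + 2)) * v k)

theorem shanks (hv : ∀ k, v k * (1 - q ^ (2 * k + 1)) = 1) (n : ℕ) :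
    ∑ s ∈ Finset.range (2 * n), q ^ (s * (s + 1) / 2) =
      ∑ s ∈ Finset.range n, QQ q v n s * q ^ (s * (2 * n + 1)) := by
  induction n with
  | zero => simp
  | succ n ih =>
    rw [show 2 * (n + 1) = 2 * n + 1 + 1 by ring, Finset.sum_range_succ, Finset.sum_range_succ, ih,
      Finset.sum_range_succ]
    have e1 : 2 * n * (2 * n + 1) / 2 = n * (2 * n + 1) := by
      rw [mul_assoc]; simp
    have e2 : (2 * n + 1) * (2 * n + 1 + 1) / 2 = (2 * n + 1) * (n + 1) := by
      rw [show (2 * n + 1) * (2 * n + 1 + 1) = 2 * ((2 * n + 1) * (n + 1)) by ring]; simp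
    rw [e1, e2]
    set D : ℕ → R := fun s => QQ q v n s * (1 - q ^ (2 * s)) * q ^ (s * (2 * n + 1)) with hD
    have top : ∀ s, s ≤ n → QQ q v (n + 1) s = QQ q v n s * ((1 - q ^ (2 * n + 2)) * v n) := by
      intro s hs
      rw [QQ, Finset.prod_Ico_succ_top hs, QQ]
    have bot : ∀ s, s < n → QQ q v n s = ((1 - q ^ (2 * s + 2)) * v s) * QQ q v n (s + 1) := by
      intro s hs
      rw [QQ, Finset.prod_eq_prod_Ico_succ_bot hs, QQ]
    have step : ∀ s ∈ Finset.range n, QQ q v (n + 1) s * q ^ (s * (2 * n + 1 + 1 + 1)) =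
        QQ q v n s * q ^ (s * (2 * n + 1)) + v n * (D (s + 1) - D s) := by
      intro s hs
      have hs := Finset.mem_range.mp hs
      have hDs : D (s + 1) = QQ q v n s * (1 - q ^ (2 * s + 1)) * q ^ ((s + 1) * (2 * n + 1)) := by
        simp only [hD]
        rw [bot s hs, show 2 * (s + 1) = 2 * s + 2 by ring]
        linear_combination (-QQ q v n (s + 1) * (1 - q ^ (2 * s + 2)) *
          q ^ ((s + 1) * (2 * n + 1))) * hv s
      rw [hDs, top s hs.le]
      simp only [hD]
      linear_combination (QQ q v n s * q ^ (s * (2 * n + 1))) * hv n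
    rw [Finset.sum_congr rfl step, Finset.sum_add_distrib, ← Finset.mul_sum, Finset.sum_range_sub,
      top n le_rfl]
    have hnn : QQ q v n n = 1 := by simp [QQ]
    simp only [hD, hnn]
    simp only [mul_zero, pow_zero, sub_self, zero_mul]
    linear_combination (-q ^ (n * (2 * n + 1)) * (1 + q ^ (2 * n + 1))) * hv n
end shanks

theorem coeff_sum_tri (L d : ℕ) (hd : d < 2 * L) :
    coeff d (∑ s ∈ Finset.range (2 * L), (X : PS) ^ (s * (s + 1) / 2)) = coeff d psi := by
  have hev : ∀ s, 2 * (s * (s + 1) / 2) = s * (s + 1) := fun s =>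
    Nat.mul_div_cancel' (Nat.even_mul_succ_self s).two_dvd
  rw [map_sum]
  simp only [coeff_X_pow, psi, coeff_mk]
  split_ifs with h
  · obtain ⟨s, hs⟩ := h
    rw [Finset.sum_eq_single s]
    · rw [if_pos]; have := hev s; omega
    · intro t _ hts
      rw [if_neg]
      intro h
      have h2 := hev t
      have h3 : t * (t + 1) = s * (s + 1) := by omega
      rcases lt_or_gt_of_ne hts with h | h <;> nlinarith
    · intro h
      exfalso; apply h
      rw [Finset.mem_range]
      rcases Nat.eq_zero_or_pos s with rfl | h0
      · omega
      · nlinarith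
  · apply Finset.sum_eq_zero
    intro s _
    rw [if_neg]
    intro hs
    exact h ⟨s, by rw [hs, hev]⟩

noncomputable def OO (L : ℕ) : PS := ∏ i ∈ Finset.range L, (1 - X ^ (2 * i + 1))
noncomputable def EE (L : ℕ) : PS := ∏ i ∈ Finset.range L, (1 - X ^ (2 * i + 2))

theorem gauss (L : ℕ) : ∃ P : PS, P * OO L = EE L ∧ (X : PS) ^ (2 * L) ∣ psi - P := by
  set v : ℕ → PS := fun k => (1 - X ^ (2 * k + 1))⁻¹ with hvd
  have hv : ∀ k, v k * (1 - X ^ (2 * k + 1)) = 1 := fun k =>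
    PowerSeries.inv_mul_cancel _ (by simp)
  refine ⟨QQ X v L 0, ?_, ?_⟩
  · rw [QQ, OO, EE, ← Finset.range_eq_Ico, ← Finset.prod_mul_distrib]
    apply Finset.prod_congr rfl
    intro k _
    linear_combination (1 - X ^ (2 * k + 2)) * hv k
  · rw [X_pow_dvd_iff]
    intro d hd
    rw [map_sub, ← coeff_sum_tri L d hd, shanks X v hv, ← map_sub]
    revert d
    rw [← X_pow_dvd_iff]
    rcases L with _ | L
    · simp
    rw [Finset.sum_range_succ']
    simp only [zero_mul, pow_zero, mul_one, add_sub_cancel_right]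
    apply Finset.dvd_sum
    intro s _
    apply Dvd.dvd.mul_left
    apply pow_dvd_pow
    nlinarith

/-! ### generating function -/

def WS (S : Finset (ℕ × ℕ)) (d : ℕ) : Set (Multiset (ℕ × ℕ)) :=
  {s | (∀ p ∈ s, p ∈ S) ∧ (s.map Prod.fst).sum = d}

theorem WS_finite (S : Finset (ℕ × ℕ)) (hS : ∀ p ∈ S, 0 < p.1) (d : ℕ) : (WS S d).Finite := by
  apply (Set.finite_Iic (d • S.val)).subset
  rintro s ⟨h1, h2⟩
  rw [Set.mem_Iic, Multiset.le_iff_count]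
  intro p
  rw [Multiset.count_nsmul]
  by_cases hp : p ∈ s
  · have h3 : Multiset.count p S.val = 1 :=
      Multiset.count_eq_one_of_mem S.nodup (h1 p hp)
    rw [h3, mul_one, ← h2]
    calc Multiset.count p s ≤ Multiset.card s := Multiset.count_le_card _ _
      _ = Multiset.card (s.map Prod.fst) • 1 := by simp
      _ ≤ (s.map Prod.fst).sum := by
        apply Multiset.card_nsmul_le_sum
        intro x hx
        obtain ⟨y, hy, rfl⟩ := Multiset.mem_map.mp hx
        exact hS y (h1 y hy)
  · rw [Multiset.count_eq_zero_of_notMem hp]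
    exact Nat.zero_le _

noncomputable def GG (S : Finset (ℕ × ℕ)) : PS := PowerSeries.mk fun d => ((WS S d).ncard : ZMod 3)

theorem GG_empty : GG ∅ = 1 := by
  ext d
  rw [GG, coeff_mk, coeff_one]
  have : WS ∅ d = if d = 0 then {0} else ∅ := by
    ext s
    simp only [WS, Finset.notMem_empty, Set.mem_ofPred_eq]
    constructor
    · rintro ⟨h1, h2⟩
      have : s = 0 := Multiset.eq_zero_of_forall_notMem h1
      subst this
      simp at h2
      simp [← h2]
    · split_ifs with h
      · rintro rfl; simp [h]
      · simp
  rw [this]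
  split_ifs <;> simp

theorem GG_insert (S : Finset (ℕ × ℕ)) (p : ℕ × ℕ) (hp : p ∉ S)
    (hS : ∀ x ∈ insert p S, 0 < x.1) : GG (insert p S) * (1 - X ^ p.1) = GG S := by
  ext d
  rw [mul_sub, mul_one, map_sub, coeff_mul_X_pow', sub_eq_iff_eq_add]
  simp only [GG, coeff_mk]
  have hfin := WS_finite (insert p S) hS
  have hsplit : WS (insert p S) d = WS S d ∪ {s | s ∈ WS (insert p S) d ∧ p ∈ s} := by
    ext s
    simp only [WS, Set.mem_union, Set.mem_ofPred_eq, Finset.mem_insert]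
    constructor
    · rintro ⟨h1, h2⟩
      by_cases hps : p ∈ s
      · exact Or.inr ⟨⟨h1, h2⟩, hps⟩
      · refine Or.inl ⟨fun x hx => (h1 x hx).resolve_left ?_, h2⟩
        rintro rfl; exact hps hx
    · rintro (⟨h1, h2⟩ | ⟨h, _⟩)
      · exact ⟨fun x hx => Or.inr (h1 x hx), h2⟩
      · exact h
  have hdisj : Disjoint (WS S d) {s | s ∈ WS (insert p S) d ∧ p ∈ s} := by
    rw [Set.disjoint_left]
    rintro s ⟨h1, _⟩ ⟨_, h3⟩
    exact hp (h1 p h3)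
  rw [hsplit, Set.ncard_union_eq hdisj ((hfin d).subset (hsplit ▸ Set.subset_union_left))
    ((hfin d).subset fun s hs => hs.1), Nat.cast_add]
  congr 1
  split_ifs with h
  · congr 1
    have : {s | s ∈ WS (insert p S) d ∧ p ∈ s} =
        Set.image (fun s => p ::ₘ s) (WS (insert p S) (d - p.1)) := by
      ext s
      simp only [WS, Set.mem_ofPred_eq, Set.mem_image]
      constructor
      · rintro ⟨⟨h1, h2⟩, h3⟩
        obtain ⟨t, rfl⟩ := Multiset.exists_cons_of_mem h3
        refine ⟨t, ⟨fun x hx => h1 x (Multiset.mem_cons_of_mem hx), ?_⟩, rfl⟩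
        simp at h2; omega
      · rintro ⟨t, ⟨h1, h2⟩, rfl⟩
        refine ⟨⟨?_, ?_⟩, Multiset.mem_cons_self _ _⟩
        · intro x hx
          rcases Multiset.mem_cons.mp hx with rfl | hx
          · exact Finset.mem_insert_self _ _
          · exact h1 x hx
        · simp [h2]; omega
    rw [this, Set.ncard_image_of_injective]
    intro a b hab
    simpa using hab
  · have : {s | s ∈ WS (insert p S) d ∧ p ∈ s} = ∅ := by
      ext s
      simp only [WS, Set.mem_ofPred_eq, Set.mem_empty_iff_false, iff_false]
      rintro ⟨⟨h1, h2⟩, h3⟩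
      obtain ⟨t, rfl⟩ := Multiset.exists_cons_of_mem h3
      simp at h2; omega
    rw [this]; simp

theorem GG_prod (S : Finset (ℕ × ℕ)) : (∀ p ∈ S, 0 < p.1) →
    GG S * ∏ p ∈ S, (1 - (X : PS) ^ p.1) = 1 := by
  induction S using Finset.induction_on with
  | empty => intro _; rw [GG_empty]; simp
  | insert p S hp ih =>
    intro h
    rw [Finset.prod_insert hp, ← mul_assoc, GG_insert S p hp h]
    exact ih fun x hx => h x (Finset.mem_insert_of_mem hx)

def oddPairs (L : ℕ) : Finset (ℕ × ℕ) :=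
  ((Finset.range L) ×ˢ (Finset.Icc 1 26)).image fun x => (2 * x.1 + 1, x.2)
def evenPairs (L : ℕ) : Finset (ℕ × ℕ) := (Finset.range L).image fun i => (2 * i + 2, 1)

theorem mem_oddPairs (L : ℕ) (p : ℕ × ℕ) :
    p ∈ oddPairs L ↔ p.1 % 2 = 1 ∧ p.1 < 2 * L ∧ 1 ≤ p.2 ∧ p.2 ≤ 26 := by
  simp only [oddPairs, Finset.mem_image, Finset.mem_product, Finset.mem_range, Finset.mem_Icc]
  constructor
  · rintro ⟨x, ⟨h1, h2⟩, rfl⟩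
    simp only; omega
  · rintro h
    refine ⟨(p.1 / 2, p.2), by simp only; omega, ?_⟩
    ext <;> simp only; omega

theorem mem_evenPairs (L : ℕ) (p : ℕ × ℕ) :
    p ∈ evenPairs L ↔ p.1 % 2 = 0 ∧ 0 < p.1 ∧ p.1 ≤ 2 * L ∧ p.2 = 1 := by
  simp only [evenPairs, Finset.mem_image, Finset.mem_range]
  constructor
  · rintro ⟨x, h1, rfl⟩
    refine ⟨?_, ?_, ?_, rfl⟩ <;> simp only <;> omega
  · rintro h
    refine ⟨p.1 / 2 - 1, by omega, ?_⟩
    ext <;> simp only <;> omega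

theorem prod_odd (L : ℕ) : ∏ p ∈ oddPairs L, (1 - (X : PS) ^ p.1) = OO L ^ 26 := by
  rw [oddPairs, Finset.prod_image, Finset.prod_product, OO, ← Finset.prod_pow]
  · simp
  · intro x _ y _ h
    simp only [Prod.mk.injEq] at h
    ext <;> omega

theorem prod_even (L : ℕ) : ∏ p ∈ evenPairs L, (1 - (X : PS) ^ p.1) = EE L := by
  rw [evenPairs, Finset.prod_image, EE]
  intro x _ y _ h
  simp only [Prod.mk.injEq] at h
  omega

theorem a_eq (L d : ℕ) (hd : d < 2 * L) :
    ((a 26 d : ℕ) : ZMod 3) = coeff d (GG (oddPairs L ∪ evenPairs L)) := by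
  rw [a, GG, coeff_mk, Nat.card_coe_set_eq]
  congr 2
  ext s
  simp only [coloredOddPartitions, WS, Set.mem_ofPred_eq, Finset.mem_union, mem_oddPairs,
    mem_evenPairs]
  constructor
  · rintro ⟨h1, h2⟩
    refine ⟨fun p hp => ?_, h2⟩
    have hle : p.1 ≤ d := by
      rw [← h2]
      exact Multiset.single_le_sum (fun _ _ => Nat.zero_le _) _ (Multiset.mem_map_of_mem _ hp)
    obtain ⟨ha, hb, hc, he⟩ := h1 p hp
    rw [Nat.even_iff] at he
    omega
  · rintro ⟨h1, h2⟩
    refine ⟨fun p hp => ?_, h2⟩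
    have := h1 p hp
    rw [Nat.even_iff]
    omega

theorem stmt16 (n : ℕ) : a 26 (27 * n + 26) ≡ 0 [MOD 3] := by
  rw [← ZMod.natCast_eq_natCast_iff]
  set d := 27 * n + 26 with hd
  have hdL : d < 2 * (d + 1) := by omega
  rw [a_eq (d + 1) d hdL]
  set L := d + 1
  have hG := GG_prod (oddPairs L ∪ evenPairs L) (by
    intro p hp
    rw [Finset.mem_union, mem_oddPairs, mem_evenPairs] at hp
    omega)
  rw [Finset.prod_union (by
    rw [Finset.disjoint_left]
    intro p
    rw [mem_oddPairs, mem_evenPairs]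
    omega), prod_odd, prod_even] at hG
  obtain ⟨P, hP, hdvd⟩ := gauss L
  set G := GG (oddPairs L ∪ evenPairs L)
  have hcO : constantCoeff (OO L) ≠ 0 := by
    simp [OO, map_prod]
  have hcpsi : constantCoeff psi ≠ 0 := by
    rw [← coeff_zero_eq_constantCoeff_apply, psi, coeff_mk, if_pos ⟨0, by simp⟩]
    exact one_ne_zero
  set J : PS := (psi * OO L)⁻¹
  have hJ : J * (psi * OO L) = 1 := PowerSeries.inv_mul_cancel _ (by simp [hcO, hcpsi])
  have hJ27 : J ^ 27 * (psi ^ 27 * OO L ^ 27) = 1 := by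
    rw [← mul_pow, ← mul_pow, hJ, one_pow]
  have hdiff : (X : PS) ^ (2 * L) ∣ G - psi ^ 26 * J ^ 27 := by
    have : G - psi ^ 26 * J ^ 27 = (psi - P) * (psi ^ 26 * J ^ 27 * G * OO L ^ 27) := by
      rw [← hP] at hG
      linear_combination (-G) * hJ27 + (psi ^ 26 * J ^ 27) * hG
    rw [this]
    exact hdvd.mul_right _
  have h0 := X_pow_dvd_iff.mp hdiff d hdL
  rw [map_sub, hd, coeff_main, sub_zero] at h0
  rw [h0]; simp
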